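/- arXiv:1912.13328 — 3 statements merged into one kernel-verified Lean document; each statement's English description precedes it below -/
import Mathlib

section
/- For each integer t ≥ 2 there exists a constant c > 0 such that every regular K_{2,t}-free graph G that contains at least one cycle (i.e. is not a forest) contains an induced cycle of length at least c·χ(G)·log χ(G), where χ(G) is the chromatic number of G. -/
/-- `G` has an induced cycle of length `ℓ`: a cycle whose support induces exactly the cycle. -/
def HasInducedCycleLen {V : Type} (G : SimpleGraph V) (ℓ : ℕ) : Prop :=
  ∃ (v : V) (w : G.Walk v v), w.IsCycle ∧ w.toSubgraph.IsInduced ∧ w.length = ℓ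

open Finset

/-- The colourings `V → Fin q` that are proper on the subgraph induced by `S`. -/
noncomputable def properOn {V : Type} [Fintype V] [DecidableEq V] (G : SimpleGraph V)
    (q : ℕ) (S : Finset V) : Finset (V → Fin q) :=
  open Classical in univ.filter fun f => ∀ u ∈ S, ∀ w ∈ S, G.Adj u w → f u ≠ f w

/-- The colours not used by `f` on the neighbours of `v` in `S`. -/
noncomputable def availableColors {V : Type} (G : SimpleGraph V) {q : ℕ} (S : Finset V)
    (f : V → Fin q) (v : V) : Finset (Fin q) :=
  open Classical in univ.filter fun γ => ∀ u ∈ S, G.Adj v u → f u ≠ γ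

section Coloring

variable {V : Type} [Fintype V] [DecidableEq V] {G : SimpleGraph V} {q : ℕ}

lemma mem_properOn {S : Finset V} {f : V → Fin q} :
    f ∈ properOn G q S ↔ ∀ u ∈ S, ∀ w ∈ S, G.Adj u w → f u ≠ f w := by
  simp [properOn]

omit [Fintype V] [DecidableEq V] in
lemma mem_availableColors {S : Finset V} {f : V → Fin q} {v : V} {γ : Fin q} :
    γ ∈ availableColors G S f v ↔ ∀ u ∈ S, G.Adj v u → f u ≠ γ := by
  simp [availableColors]

omit [Fintype V] in
lemma availableColors_update {S : Finset V} {f : V → Fin q} {u v : V} {γ : Fin q} (hu : u ∉ S) :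
    availableColors G S (Function.update f u γ) v = availableColors G S f v := by
  ext δ
  simp only [mem_availableColors]
  refine forall₂_congr fun w hw => ?_
  rw [Function.update_of_ne (ne_of_mem_of_not_mem hw hu)]

lemma update_mem_properOn_insert {S : Finset V} {f : V → Fin q} {v : V} {γ : Fin q} (hv : v ∉ S) :
    Function.update f v γ ∈ properOn G q (insert v S) ↔
      f ∈ properOn G q S ∧ γ ∈ availableColors G S f v := by
  have hne : ∀ w ∈ S, w ≠ v := fun w hw => ne_of_mem_of_not_mem hw hv
  simp only [mem_properOn, mem_availableColors]
  constructor
  · intro h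
    refine ⟨fun u hu w hw huw => ?_, fun u hu huv => ?_⟩
    · simpa [hne u hu, hne w hw] using h u (mem_insert_of_mem hu) w (mem_insert_of_mem hw) huw
    · simpa [hne u hu] using h u (mem_insert_of_mem hu) v (mem_insert_self v S) huv.symm
  · rintro ⟨h₁, h₂⟩ u hu w hw huw
    rcases mem_insert.1 hu with rfl | hu' <;> rcases mem_insert.1 hw with rfl | hw'
    · exact absurd huw (G.loopless.irrefl _)
    · simpa [hne w hw'] using (h₂ w hw' huw).symm
    · simpa [hne u hu'] using h₂ u hu' huw.symm
    · simpa [hne u hu', hne w hw'] using h₁ u hu' w hw' huw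

lemma sum_sum_update (H : (V → Fin q) → ℝ) (v : V) :
    ∑ f, ∑ γ, H (Function.update f v γ) = q * ∑ f, H f := by
  have hinv : Function.Involutive fun x : (V → Fin q) × Fin q =>
      (Function.update x.1 v x.2, x.1 v) := fun x => by simp
  rw [← Fintype.sum_prod_type' (f := fun f γ => H (Function.update f v γ)),
    Fintype.sum_equiv hinv.toPerm (fun x => H (Function.update x.1 v x.2)) (fun x => H x.1)
      (fun x => rfl), Fintype.sum_prod_type]
  simp [mul_sum]

lemma mul_sum_properOn_insert {S : Finset V} {v : V} (hv : v ∉ S) (F : (V → Fin q) → ℝ) :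
    q * ∑ f ∈ properOn G q (insert v S), F f =
      ∑ f ∈ properOn G q S, ∑ γ ∈ availableColors G S f v, F (Function.update f v γ) := by
  have h := sum_sum_update (fun f => if f ∈ properOn G q (insert v S) then F f else 0) v
  rw [← sum_filter, filter_mem_eq_inter, univ_inter] at h
  rw [← h]
  simp only [update_mem_properOn_insert hv, ite_and]
  rw [← sum_subset (subset_univ (properOn G q S))]
  · refine sum_congr rfl fun f hf => ?_
    simp [hf]
  · intro f _ hf
    simp [hf]

lemma mul_card_properOn_insert {S : Finset V} {v : V} (hv : v ∉ S) :
    (q : ℝ) * #(properOn G q (insert v S)) =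
      ∑ f ∈ properOn G q S, (#(availableColors G S f v) : ℝ) := by
  simpa using mul_sum_properOn_insert (G := G) (q := q) hv fun _ => 1

/-- Resampling the colour of `u` bounds the proportion of colourings that give `u` the
colour `γ`. -/
lemma sum_ite_color_le {S : Finset V} {u : V} (hu : u ∈ S) (hq : 0 < q) (γ : Fin q)
    (F p : (V → Fin q) → ℝ) (hF : ∀ f, 0 ≤ F f) (hp : ∀ f, 0 ≤ p f)
    (hFu : ∀ f δ, F (Function.update f u δ) = F f) (hpu : ∀ f δ, p (Function.update f u δ) = p f)
    (h : ∀ f, F f ≠ 0 → γ ∈ availableColors G (S.erase u) f u →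
      1 ≤ p f * #(availableColors G (S.erase u) f u)) :
    ∑ f ∈ properOn G q S, F f * (if f u = γ then 1 else 0) ≤
      ∑ f ∈ properOn G q S, F f * p f := by
  have hq' : (0 : ℝ) < q := by exact_mod_cast hq
  refine le_of_mul_le_mul_left ?_ hq'
  rw [← insert_erase hu, mul_sum_properOn_insert (notMem_erase u S),
    mul_sum_properOn_insert (notMem_erase u S)]
  refine sum_le_sum fun f _ => ?_
  simp only [hFu, hpu, Function.update_self, ← mul_sum, sum_const, nsmul_eq_mul, sum_ite_eq']
  rcases eq_or_ne (F f) 0 with h0 | h0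
  · simp [h0]
  refine mul_le_mul_of_nonneg_left ?_ (hF f)
  split_ifs with hγ
  · rw [mul_comm]; exact h f h0 hγ
  · exact mul_nonneg (Nat.cast_nonneg _) (hp f)

/-- A lower bound for the proportion of colourings that avoid `γ` at all good vertices of `D`. -/
lemma sum_prod_one_sub_le {S : Finset V} (hq : 0 < q) (γ : Fin q) (D : Finset V) (hD : D ⊆ S)
    (good : V → (V → Fin q) → Prop) [∀ u f, Decidable (good u f)] (p : V → (V → Fin q) → ℝ)
    (hp₀ : ∀ u f, 0 ≤ p u f) (hp₁ : ∀ u f, p u f ≤ 1)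
    (hgu : ∀ w ∈ D, ∀ u f δ, good u (Function.update f w δ) ↔ good u f)
    (hpu : ∀ w ∈ D, ∀ u f δ, p u (Function.update f w δ) = p u f)
    (h : ∀ u ∈ D, ∀ f, good u f → γ ∈ availableColors G (S.erase u) f u →
      1 ≤ p u f * #(availableColors G (S.erase u) f u))
    (F : (V → Fin q) → ℝ) (hF : ∀ f, 0 ≤ F f)
    (hFu : ∀ w ∈ D, ∀ f δ, F (Function.update f w δ) = F f) :
    ∑ f ∈ properOn G q S, F f * ∏ u ∈ D, (1 - p u f) ≤
      ∑ f ∈ properOn G q S, F f * ∏ u ∈ D, (if good u f ∧ f u = γ then 0 else 1) := by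
  induction D using Finset.induction_on generalizing F with
  | empty => simp
  | insert u D hu ih =>
    have hsub : D ⊆ insert u D := subset_insert u D
    have huD : u ∈ insert u D := mem_insert_self u D
    have step := ih (hsub.trans hD) (fun w hw => hgu w (hsub hw)) (fun w hw => hpu w (hsub hw))
      (fun w hw => h w (hsub hw)) (fun f => F f * (1 - p u f))
      (fun f => mul_nonneg (hF f) (sub_nonneg.2 (hp₁ u f)))
      (fun w hw f δ => by simp only [hFu w (hsub hw), hpu w (hsub hw)])
    set I : (V → Fin q) → ℝ := fun f => ∏ w ∈ D, (if good w f ∧ f w = γ then 0 else 1) with hI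
    have hI₀ : ∀ f, 0 ≤ I f := fun f => prod_nonneg fun w _ => by split_ifs <;> norm_num
    have hIu : ∀ f δ, I (Function.update f u δ) = I f := fun f δ =>
      prod_congr rfl fun w hw => by
        simp only [Function.update_of_ne (ne_of_mem_of_not_mem hw hu), hgu u huD]
    have resample := sum_ite_color_le (G := G) (hD huD) hq γ
      (fun f => F f * I f * (if good u f then 1 else 0)) (p u)
      (fun f => mul_nonneg (mul_nonneg (hF f) (hI₀ f)) (by split_ifs <;> norm_num)) (hp₀ u)
      (fun f δ => by simp only [hFu u huD, hIu, hgu u huD]) (hpu u huD u)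
      (fun f hf => h u huD f (by by_contra hg; simp [hg] at hf))
    calc
      _ = ∑ f ∈ properOn G q S, F f * (1 - p u f) * ∏ w ∈ D, (1 - p w f) :=
        sum_congr rfl fun f _ => by rw [prod_insert hu, mul_assoc]
      _ ≤ ∑ f ∈ properOn G q S, F f * (1 - p u f) * I f := step
      _ ≤ ∑ f ∈ properOn G q S, (F f * I f -
          F f * I f * (if good u f then 1 else 0) * p u f) := sum_le_sum fun f _ => by
        have h₁ := mul_nonneg (mul_nonneg (hF f) (hI₀ f)) (hp₀ u f)
        split_ifs <;> nlinarith
      _ ≤ ∑ f ∈ properOn G q S, (F f * I f -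
          F f * I f * (if good u f then 1 else 0) * (if f u = γ then 1 else 0)) := by
        rw [sum_sub_distrib, sum_sub_distrib]
        exact sub_le_sub_left resample _
      _ = _ := sum_congr rfl fun f _ => by
        rw [prod_insert hu]
        by_cases h₁ : good u f <;> by_cases h₂ : f u = γ <;> simp [h₁, h₂, hI]


omit [Fintype V] in
lemma card_availableColors_le_add {S T : Finset V} (f : V → Fin q) (v : V) (R : Finset V)
    (hR : ∀ u ∈ T, G.Adj v u → u ∉ S → u ∈ R) :
    #(availableColors G S f v) ≤ #(availableColors G T f v) + #R := by
  classical
  refine (card_le_card (t := availableColors G T f v ∪ R.image f) fun γ hγ => ?_).trans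
    ((card_union_le _ _).trans (Nat.add_le_add_left card_image_le _))
  rw [mem_availableColors] at hγ
  by_contra hno
  simp only [mem_union, mem_availableColors, mem_image, not_or, not_exists, not_and] at hno
  refine hno.1 fun u hu hvu huγ => ?_
  by_cases huS : u ∈ S
  · exact hγ u huS hvu huγ
  · exact hno.2 u (hR u hu hvu huS) huγ

lemma exp_neg_two_mul_le {x : ℝ} (h₀ : 0 ≤ x) (h₁ : x ≤ 1 / 2) : Real.exp (-(2 * x)) ≤ 1 - x := by
  rw [Real.exp_neg]
  refine (inv_anti₀ (by linarith) (Real.add_one_le_exp (2 * x))).trans ?_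
  rw [inv_le_iff_one_le_mul₀ (by linarith)]
  nlinarith

/-- Jensen's inequality for `exp`. -/
lemma card_mul_exp_le_sum_exp {ι : Type*} (s : Finset ι) (x : ι → ℝ) {m : ℝ}
    (h : ∑ i ∈ s, x i ≤ #s * m) : #s * Real.exp (-m) ≤ ∑ i ∈ s, Real.exp (-x i) := by
  have key : ∀ i ∈ s, Real.exp (-m) * (1 + m - x i) ≤ Real.exp (-x i) := fun i _ => by
    have hx : -x i = -m + (m - x i) := by ring
    rw [hx, Real.exp_add]
    exact mul_le_mul_of_nonneg_left (by linarith [Real.add_one_le_exp (m - x i)])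
      (Real.exp_pos _).le
  refine le_trans ?_ (sum_le_sum key)
  rw [← mul_sum, sum_sub_distrib, sum_const, nsmul_eq_mul, mul_comm]
  exact mul_le_mul_of_nonneg_left (by linarith) (Real.exp_pos _).le

/-- Adding a vertex multiplies the number of proper colourings by at least `ℓ`, where colourings
are counted as total functions. -/
lemma mul_card_properOn_le {t Δ : ℕ} (ht : 2 ≤ t) (hq : 0 < q) {ℓ : ℝ} (hℓ : 0 < ℓ)
    [DecidableRel G.Adj]
    (hcod : ∀ u v, u ≠ v → #(G.neighborFinset u ∩ G.neighborFinset v) < t)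
    (hdeg : ∀ v, G.degree v ≤ Δ)
    (hqℓ : ℓ + Δ * (2 * t / ℓ) ≤ q * Real.exp (-(4 * Δ / q))) (S : Finset V) {v : V}
    (hv : v ∉ S) : ℓ * #(properOn G q S) ≤ q * #(properOn G q (insert v S)) := by
  induction S using Finset.strongInduction generalizing v with
  | H S ih =>
  classical
  have hq' : (0 : ℝ) < q := by exact_mod_cast hq
  have ht' : (2 : ℝ) ≤ t := by exact_mod_cast ht
  set A := properOn G q S
  set D := S.filter (G.Adj v)
  have hDS : D ⊆ S := filter_subset _ _
  have hDcard : #D ≤ Δ := (card_le_card fun u hu => by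
    simpa using (mem_filter.1 hu).2 : #D ≤ #(G.neighborFinset v)).trans (hdeg v)
  set L : V → (V → Fin q) → Finset (Fin q) := fun u f => availableColors G (S \ D) f u
  have hLu : ∀ w ∈ D, ∀ u f δ, L u (Function.update f w δ) = L u f := fun w hw u f δ =>
    availableColors_update (by simp [hw])
  let good : V → (V → Fin q) → Prop := fun u f => 2 * t ≤ #(L u f)
  have hLcard : ∀ u ∈ D, ∀ f, #(L u f) < #(availableColors G (S.erase u) f u) + t := by
    intro u hu f
    have hvu : G.Adj v u := (mem_filter.1 hu).2
    refine (card_availableColors_le_add (T := S.erase u) f u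
      (G.neighborFinset u ∩ G.neighborFinset v) fun w hw huw hwS => ?_).trans_lt
      (Nat.add_lt_add_left (hcod u v hvu.ne') _)
    have hwS' := mem_of_mem_erase hw
    have : w ∈ D := by simpa [hwS'] using hwS
    simpa using ⟨huw, (mem_filter.1 this).2⟩
  have hsub : ∀ u f, availableColors G (S.erase u) f u ⊆ L u f := fun u f γ hγ => by
    rw [mem_availableColors] at hγ ⊢
    exact fun w hw huw => hγ w (mem_erase.2 ⟨huw.ne', (mem_sdiff.1 hw).1⟩) huw
  let p : Fin q → V → (V → Fin q) → ℝ := fun γ u f =>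
    if good u f ∧ γ ∈ L u f then 2 / #(L u f) else 0
  have hp₀ : ∀ γ u f, 0 ≤ p γ u f := fun γ u f => by
    simp only [p]; split_ifs <;> positivity
  have hp₁ : ∀ γ u f, p γ u f ≤ 1 / 2 := fun γ u f => by
    simp only [p]
    split_ifs with h
    · have : (2 * t : ℝ) ≤ #(L u f) := by exact_mod_cast h.1
      rw [div_le_div_iff₀ (by linarith) two_pos]
      linarith
    · norm_num
  have hsump : ∀ f, ∑ γ, ∑ u ∈ D, 2 * p γ u f ≤ #(univ : Finset (Fin q)) * (4 * Δ / q) := by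
    intro f
    rw [card_univ, Fintype.card_fin, mul_div_cancel₀ _ hq'.ne', sum_comm]
    calc
      _ ≤ ∑ u ∈ D, (4 : ℝ) := sum_le_sum fun u _ => by
        by_cases hg : good u f
        · have : (2 * t : ℝ) ≤ #(L u f) := by exact_mod_cast hg
          simp only [p, hg, true_and, ← mul_sum]
          rw [← sum_filter, filter_mem_eq_inter, univ_inter, sum_const, nsmul_eq_mul,
            mul_div_cancel₀ _ (by linarith)]
          norm_num
        · simp [p, hg]
      _ ≤ 4 * Δ := by
        rw [sum_const, nsmul_eq_mul, mul_comm]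
        gcongr
  have hprod : ∀ f, q * Real.exp (-(4 * Δ / q)) ≤ ∑ γ, ∏ u ∈ D, (1 - p γ u f) := by
    intro f
    have h := card_mul_exp_le_sum_exp univ (fun γ => ∑ u ∈ D, 2 * p γ u f) (hsump f)
    rw [card_univ, Fintype.card_fin] at h
    refine h.trans (sum_le_sum fun γ _ => ?_)
    rw [← sum_neg_distrib, Real.exp_sum]
    exact prod_le_prod (fun u _ => (Real.exp_pos _).le)
      fun u _ => exp_neg_two_mul_le (hp₀ γ u f) (hp₁ γ u f)
  have havoid : ∀ γ, ∑ f ∈ A, ∏ u ∈ D, (1 - p γ u f) ≤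
      ∑ f ∈ A, ∏ u ∈ D, (if good u f ∧ f u = γ then (0 : ℝ) else 1) := by
    intro γ
    have h := sum_prod_one_sub_le (G := G) hq γ D hDS good (p γ) (hp₀ γ)
      (fun u f => (hp₁ γ u f).trans (by norm_num))
      (fun w hw u f δ => by simp only [good, hLu w hw])
      (fun w hw u f δ => by simp only [p, good, hLu w hw])
      (fun u hu f hg hγ => ?_) (fun _ => 1) (fun _ => zero_le_one) (fun _ _ _ _ => rfl)
    · simpa using h
    · have h₁ : (#(L u f) : ℝ) ≤ #(availableColors G (S.erase u) f u) + t := by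
        exact_mod_cast (hLcard u hu f).le
      have h₂ : (2 * t : ℝ) ≤ #(L u f) := by exact_mod_cast hg
      simp only [p, hg, hsub u f hγ, and_self, if_true]
      rw [div_mul_eq_mul_div, le_div_iff₀ (by linarith)]
      linarith
  have hcount : ∀ f, ∑ γ, ∏ u ∈ D, (if good u f ∧ f u = γ then (0 : ℝ) else 1) ≤
      #(availableColors G S f v) + #{u ∈ D | ¬ good u f} := by
    intro f
    have h : #(univ.filter fun γ => ∀ u ∈ D, ¬ (good u f ∧ f u = γ)) ≤
        #(availableColors G S f v) + #{u ∈ D | ¬ good u f} := by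
      refine (card_le_card (t := availableColors G {u ∈ S | good u f} f v) fun γ hγ => ?_).trans
        (card_availableColors_le_add f v _ fun u hu hvu hug => ?_)
      · rw [mem_availableColors]
        intro u hu hvu huγ
        obtain ⟨huS, hg⟩ := mem_filter.1 hu
        exact (mem_filter.1 hγ).2 u (mem_filter.2 ⟨huS, hvu⟩) ⟨hg, huγ⟩
      · exact mem_filter.2 ⟨mem_filter.2 ⟨hu, hvu⟩, fun hg => hug (mem_filter.2 ⟨hu, hg⟩)⟩
    refine le_trans (le_of_eq ?_) ((Nat.cast_le (α := ℝ).2 h).trans_eq (Nat.cast_add _ _))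
    rw [card_filter, Nat.cast_sum]
    refine sum_congr rfl fun γ _ => ?_
    split_ifs with h
    · exact_mod_cast prod_eq_one fun u hu => if_neg (h u hu)
    · push Not at h
      obtain ⟨u, hu, h⟩ := h
      rw [Nat.cast_zero]
      exact prod_eq_zero hu (if_pos h)
  have hbad : ∀ u ∈ D, (#{f ∈ A | ¬ good u f} : ℝ) ≤ 2 * t / ℓ * #A := by
    intro u hu
    have huS := hDS hu
    have hins := insert_erase huS
    have hih := ih (S.erase u) (erase_ssubset huS) (notMem_erase u S)
    rw [hins] at hih
    have h := mul_sum_properOn_insert (G := G) (q := q) (notMem_erase u S)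
      (fun f => if #(availableColors G (S.erase u) f u) < 2 * t then (1 : ℝ) else 0)
    simp only [availableColors_update (notMem_erase u S), sum_const, nsmul_eq_mul, hins] at h
    have h₁ : (#{f ∈ A | ¬ good u f} : ℝ) ≤ ∑ f ∈ A,
        if #(availableColors G (S.erase u) f u) < 2 * t then (1 : ℝ) else 0 := by
      rw [sum_boole]
      exact_mod_cast card_le_card (monotone_filter_right A fun f _ hf =>
        (card_le_card (hsub u f)).trans_lt (not_le.1 hf))
    have h₂ : ∑ f ∈ properOn G q (S.erase u), (#(availableColors G (S.erase u) f u) : ℝ) *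
        (if #(availableColors G (S.erase u) f u) < 2 * t then 1 else 0) ≤
        2 * t * #(properOn G q (S.erase u)) := by
      rw [mul_comm (2 * (t : ℝ)), ← nsmul_eq_mul]
      refine sum_le_card_nsmul _ _ _ fun f _ => ?_
      split_ifs with hlt
      · rw [mul_one]; exact_mod_cast hlt.le
      · simp
    rw [div_mul_eq_mul_div, le_div_iff₀ hℓ]
    refine le_of_mul_le_mul_left ?_ hq'
    calc
      _ = ℓ * (q * (#{f ∈ A | ¬ good u f} : ℝ)) := by ring
      _ ≤ ℓ * (2 * t * #(properOn G q (S.erase u))) := by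
        refine mul_le_mul_of_nonneg_left ?_ hℓ.le
        exact (mul_le_mul_of_nonneg_left h₁ hq'.le).trans (h.trans_le h₂)
      _ = 2 * t * (ℓ * #(properOn G q (S.erase u))) := by ring
      _ ≤ 2 * t * (q * #A) := by gcongr
      _ = _ := by ring
  have hbadsum : ∑ f ∈ A, (#{u ∈ D | ¬ good u f} : ℝ) ≤ Δ * (2 * t / ℓ) * #A := by
    have hswap : ∑ f ∈ A, (#{u ∈ D | ¬ good u f} : ℝ) = ∑ u ∈ D, (#{f ∈ A | ¬ good u f} : ℝ) := by
      simp only [← sum_boole]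
      exact sum_comm
    rw [hswap]
    refine (sum_le_card_nsmul D _ _ hbad).trans ?_
    rw [nsmul_eq_mul, mul_assoc]
    gcongr
  have hmain : #A * (q * Real.exp (-(4 * Δ / q))) ≤
      ∑ f ∈ A, ((#(availableColors G S f v) : ℝ) + #{u ∈ D | ¬ good u f}) := by
    calc
      _ ≤ ∑ f ∈ A, ∑ γ, ∏ u ∈ D, (1 - p γ u f) := by
        rw [← nsmul_eq_mul]
        exact card_nsmul_le_sum _ _ _ fun f _ => hprod f
      _ ≤ ∑ f ∈ A, ∑ γ, ∏ u ∈ D, (if good u f ∧ f u = γ then (0 : ℝ) else 1) := by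
        rw [sum_comm, sum_comm (s := A)]
        exact sum_le_sum fun γ _ => havoid γ
      _ ≤ _ := sum_le_sum fun f _ => hcount f
  rw [sum_add_distrib, ← mul_card_properOn_insert hv] at hmain
  have := mul_le_mul_of_nonneg_left hqℓ (Nat.cast_nonneg (α := ℝ) #A)
  linarith

lemma colorable_of_exp_bound {t Δ : ℕ} (ht : 2 ≤ t) (hq : 0 < q) {ℓ : ℝ} (hℓ : 0 < ℓ)
    [DecidableRel G.Adj]
    (hcod : ∀ u v, u ≠ v → #(G.neighborFinset u ∩ G.neighborFinset v) < t)
    (hdeg : ∀ v, G.degree v ≤ Δ)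
    (hqℓ : ℓ + Δ * (2 * t / ℓ) ≤ q * Real.exp (-(4 * Δ / q))) : G.Colorable q := by
  have hne : ∀ S : Finset V, 0 < #(properOn G q S) := by
    intro S
    induction S using Finset.induction_on with
    | empty => exact card_pos.2 ⟨fun _ => ⟨0, hq⟩, mem_properOn.2 (by simp)⟩
    | insert v S hv ih =>
      have h := mul_card_properOn_le ht hq hℓ hcod hdeg hqℓ S hv
      have : (0 : ℝ) < #(properOn G q S) := by exact_mod_cast ih
      have := pos_of_mul_pos_right ((mul_pos hℓ this).trans_le h) (Nat.cast_nonneg _)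
      exact_mod_cast this
  obtain ⟨f, hf⟩ := card_pos.1 (hne univ)
  exact ⟨⟨f, fun {a b} hab => mem_properOn.1 hf a (mem_univ a) b (mem_univ b) hab⟩⟩

/-- Graphs with bounded codegrees and maximum degree `d` have chromatic number
`O(d / log d)`. -/
lemma colorable_ceil_div_log {t d : ℕ} (ht : 2 ≤ t) (hd : 2 ≤ d) [DecidableRel G.Adj]
    (hcod : ∀ u v, u ≠ v → #(G.neighborFinset u ∩ G.neighborFinset v) < t)
    (hdeg : ∀ v, G.degree v ≤ d) : G.Colorable ⌈16 * t * d / Real.log d⌉₊ := by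
  have ht' : (2 : ℝ) ≤ t := by exact_mod_cast ht
  have hd' : (2 : ℝ) ≤ d := by exact_mod_cast hd
  have hlog : 0 < Real.log d := Real.log_pos (by linarith)
  have hx : 0 < 16 * t * d / Real.log d := by positivity
  have hqx := Nat.le_ceil (16 * t * d / Real.log d)
  set q := ⌈16 * t * d / Real.log d⌉₊
  set y := Real.exp (Real.log d / 4) with hy
  have hy0 : 0 < y := Real.exp_pos _
  have hy4 : y ^ 4 = d := by
    rw [hy, ← Real.exp_nat_mul]
    push_cast
    rw [mul_div_cancel₀ _ (by norm_num), Real.exp_log (by linarith)]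
  have hlogy : Real.log d ≤ 4 * y := by
    have := Real.add_one_le_exp (Real.log d / 4)
    linarith
  have hq : (0 : ℝ) < q := hx.trans_le hqx
  have hqy : 4 * t * y ^ 3 ≤ q := by
    refine le_trans ?_ hqx
    rw [le_div_iff₀ hlog]
    calc
      _ ≤ 4 * t * y ^ 3 * (4 * y) := by gcongr
      _ = _ := by rw [← hy4]; ring
  refine colorable_of_exp_bound ht (by exact_mod_cast hq) (ℓ := 2 * t * y ^ 2) (by positivity)
    hcod hdeg ?_
  have hexp : y⁻¹ ≤ Real.exp (-(4 * d / q)) := by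
    rw [hy, ← Real.exp_neg, Real.exp_le_exp, neg_le_neg_iff, div_le_iff₀ hq]
    have := (div_le_iff₀ hlog).1 hqx
    nlinarith
  calc
    2 * t * y ^ 2 + d * (2 * t / (2 * t * y ^ 2)) = 2 * t * y ^ 2 + y ^ 2 := by
      rw [← hy4]; field_simp
    _ ≤ 4 * t * y ^ 3 * y⁻¹ := by
      have : 4 * t * y ^ 3 * y⁻¹ = 4 * t * y ^ 2 := by field_simp
      rw [this]
      nlinarith [sq_nonneg y]
    _ ≤ _ := by gcongr

end Coloring

section InducedCycle

/-- `p 0, …, p m` are the vertices of an induced path. -/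
def IsInducedPathSeq {V : Type} (G : SimpleGraph V) (p : ℕ → V) (m : ℕ) : Prop :=
  ∀ i j, i < j → j ≤ m → p i ≠ p j ∧ (G.Adj (p i) (p j) ↔ j = i + 1)

variable {V : Type} {G : SimpleGraph V}

lemma exists_isPath_of_isInducedPathSeq {p : ℕ → V} {m : ℕ} (hp : IsInducedPathSeq G p m) (i k : ℕ)
    (hk : i + k ≤ m) :
    ∃ W : G.Walk (p i) (p (i + k)), W.IsPath ∧ W.length = k ∧
      (∀ x, x ∈ W.support ↔ ∃ j ≤ k, x = p (i + j)) ∧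
      ∀ j < k, s(p (i + j), p (i + j + 1)) ∈ W.edges := by
  induction k with
  | zero => exact ⟨.nil, by simp, by simp, by simp, by simp⟩
  | succ k ih =>
    obtain ⟨W, hW, hl, hs, he⟩ := ih (by omega)
    have hadj : G.Adj (p (i + k)) (p (i + (k + 1))) :=
      (hp (i + k) (i + (k + 1)) (by omega) hk).2.2 rfl
    refine ⟨W.concat hadj, hW.concat (fun hmem => ?_) hadj, by simp [hl], fun x => ?_, ?_⟩
    · obtain ⟨j, hj, hj'⟩ := (hs _).1 hmem
      exact (hp (i + j) (i + (k + 1)) (by omega) hk).1 hj'.symm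
    · rw [SimpleGraph.Walk.support_concat, List.mem_append, hs, List.mem_singleton]
      constructor
      · rintro (⟨j, hj, rfl⟩ | rfl)
        · exact ⟨j, by omega, rfl⟩
        · exact ⟨k + 1, le_rfl, rfl⟩
      · rintro ⟨j, hj, rfl⟩
        rcases hj.lt_or_eq with hj | rfl
        · exact Or.inl ⟨j, by omega, rfl⟩
        · exact Or.inr rfl
    · intro j hj
      rw [SimpleGraph.Walk.edges_concat, List.concat_eq_append, List.mem_append, List.mem_singleton]
      rcases (Nat.lt_succ_iff.1 hj).lt_or_eq with hj | rfl
      · exact Or.inl (he j hj)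
      · exact Or.inr rfl

/-- Closing up an induced path through a new vertex `w` whose only other neighbour on `p i, …, p m`
is `p i`. -/
lemma hasInducedCycleLen_of_isInducedPathSeq {p : ℕ → V} {m : ℕ} (hp : IsInducedPathSeq G p m)
    {i : ℕ} (hi : i < m) {w : V} (hw : ∀ j ≤ m, w ≠ p j) (hwm : G.Adj (p m) w)
    (hwi : G.Adj (p i) w) (hwj : ∀ j, i < j → j < m → ¬ G.Adj (p j) w) :
    HasInducedCycleLen G (m - i + 2) := by
  obtain ⟨k, rfl⟩ : ∃ k, m = i + k := ⟨m - i, by omega⟩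
  obtain ⟨W, hW, hl, hs, he⟩ := exists_isPath_of_isInducedPathSeq hp i k le_rfl
  have hws : w ∉ W.support := fun h => by
    obtain ⟨j, hj, hj'⟩ := (hs w).1 h
    exact hw (i + j) (by omega) hj'
  have hP : (W.concat hwm).IsPath := hW.concat hws hwm
  set C : G.Walk w w := .cons hwi.symm (W.concat hwm) with hC
  have hedge : ∀ a b, a < b → b ≤ k → G.Adj (p (i + a)) (p (i + b)) →
      s(p (i + a), p (i + b)) ∈ C.edges := by
    intro a b hab hb hadj
    have : i + b = i + a + 1 := (hp (i + a) (i + b) (by omega) (by omega)).2.1 hadj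
    rw [this]
    simp [hC, he a (by omega)]
  have hedgew : ∀ a ≤ k, G.Adj (p (i + a)) w → s(p (i + a), w) ∈ C.edges := by
    intro a ha hadj
    rcases Nat.eq_zero_or_pos a with rfl | h0
    · simp [hC, Sym2.eq_swap]
    rcases ha.lt_or_eq with hak | rfl
    · exact absurd hadj (hwj (i + a) (by omega) (by omega))
    · simp [hC]
  refine ⟨w, C, ?_, ?_, by simp [hC, hl]⟩
  · rw [hC, SimpleGraph.Walk.cons_isCycle_iff]
    refine ⟨hP, fun h => ?_⟩
    rw [SimpleGraph.Walk.edges_concat, List.concat_eq_append, List.mem_append,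
      List.mem_singleton] at h
    rcases h with h | h
    · exact hws (SimpleGraph.Walk.fst_mem_support_of_mem_edges W h)
    · rw [Sym2.eq_swap, Sym2.eq_iff] at h
      rcases h with h | h
      · exact (hp i (i + k) hi le_rfl).1 h.1
      · exact hw i (by omega) h.1.symm
  · have hverts : ∀ x ∈ C.toSubgraph.verts, x = w ∨ ∃ j ≤ k, x = p (i + j) := by
      intro x hx
      simp only [hC, SimpleGraph.Walk.mem_verts_toSubgraph, SimpleGraph.Walk.support_cons,
        SimpleGraph.Walk.support_concat, List.mem_cons, List.mem_append,
        hs, List.not_mem_nil, or_false] at hx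
      tauto
    intro x hx y hy hxy
    rw [← SimpleGraph.Subgraph.mem_edgeSet, SimpleGraph.Walk.mem_edges_toSubgraph]
    rcases hverts x hx with rfl | ⟨a, ha, rfl⟩ <;> rcases hverts y hy with rfl | ⟨b, hb, rfl⟩
    · exact absurd hxy (G.loopless.irrefl _)
    · rw [Sym2.eq_swap]; exact hedgew b hb hxy.symm
    · exact hedgew a ha hxy
    · rcases lt_trichotomy a b with h | rfl | h
      · exact hedge a b h hb hxy
      · exact absurd hxy (G.loopless.irrefl _)
      · rw [Sym2.eq_swap]; exact hedge b a h ha hxy.symm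

/-- Take a longest induced path; every neighbour of its end vertex has a further neighbour on the
path, and few neighbours share the same one. -/
lemma exists_hasInducedCycleLen_of_minDegree [Fintype V] [DecidableEq V] [DecidableRel G.Adj]
    {t d : ℕ} (hcod : ∀ u v, u ≠ v → #(G.neighborFinset u ∩ G.neighborFinset v) < t) (hd : 2 ≤ d)
    (hdeg : ∀ v, d ≤ G.degree v) (v₀ : V) :
    ∃ ℓ, HasInducedCycleLen G ℓ ∧ d ≤ ℓ * t := by
  classical
  have hbound : ∀ m, (∃ p, IsInducedPathSeq G p m) → m ≤ Fintype.card V := by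
    rintro m ⟨p, hp⟩
    have hinj : Set.InjOn p (range m) := by
      intro a ha b hb hab
      simp only [coe_range, Set.mem_Iio] at ha hb
      rcases lt_trichotomy a b with h | h | h
      · exact absurd hab (hp a b h hb.le).1
      · exact h
      · exact absurd hab.symm (hp b a h ha.le).1
    simpa [card_image_of_injOn hinj] using card_le_univ ((range m).image p)
  have h0 : ∃ p, IsInducedPathSeq G p 0 := ⟨fun _ => v₀, fun i j _ _ => by omega⟩
  set m := Nat.findGreatest (fun m => ∃ p, IsInducedPathSeq G p m) (Fintype.card V)
  obtain ⟨p, hp⟩ : ∃ p, IsInducedPathSeq G p m :=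
    Nat.findGreatest_spec (P := fun m => ∃ p, IsInducedPathSeq G p m) (Nat.zero_le _) h0
  have hmax : ¬ ∃ p, IsInducedPathSeq G p (m + 1) := fun h => by
    have := Nat.le_findGreatest (P := fun m => ∃ p, IsInducedPathSeq G p m) (hbound _ h) h
    omega
  set N := (G.neighborFinset (p m)).erase (p (m - 1))
  have hNadj : ∀ w ∈ N, G.Adj (p m) w := fun w hw => by
    simpa using mem_of_mem_erase hw
  have hNp : ∀ w ∈ N, ∀ j ≤ m, w ≠ p j := by
    rintro w hw j hj rfl
    have hadj := hNadj _ hw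
    rcases hj.lt_or_eq with hj | rfl
    · have := (hp j m hj le_rfl).2.1 hadj.symm
      exact ne_of_mem_erase hw (by congr 1; omega)
    · exact G.loopless.irrefl _ hadj
  have hNback : ∀ w ∈ N, ∃ i < m, G.Adj (p i) w := by
    intro w hw
    by_contra! hno
    refine hmax ⟨Function.update p (m + 1) w, fun i j hij hj => ?_⟩
    rw [Function.update_of_ne (by omega : i ≠ m + 1)]
    rcases hj.lt_or_eq with hj | rfl
    · rw [Function.update_of_ne (by omega)]
      exact hp i j hij (by omega)
    · rw [Function.update_self]
      refine ⟨(hNp w hw i (by omega)).symm, ?_⟩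
      rcases (Nat.lt_succ_iff.1 hij).lt_or_eq with hi | rfl
      · exact iff_of_false (hno i hi) (by omega)
      · exact iff_of_true (hNadj w hw) rfl
  have hNcard : d ≤ #N + 1 := by
    have : _ ≤ #N := pred_card_le_card_erase (s := G.neighborFinset (p m)) (a := p (m - 1))
    have := hdeg (p m)
    rw [SimpleGraph.degree] at this
    omega
  have hcycle : ∀ w ∈ N, ∃ i < m, G.Adj (p i) w ∧ HasInducedCycleLen G (m - i + 2) := by
    intro w hw
    set i := Nat.findGreatest (fun i => i < m ∧ G.Adj (p i) w) m
    obtain ⟨i₀, hi₀, hadj₀⟩ := hNback w hw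
    have hspec : i < m ∧ G.Adj (p i) w :=
      Nat.findGreatest_spec (P := fun i => i < m ∧ G.Adj (p i) w) hi₀.le ⟨hi₀, hadj₀⟩
    refine ⟨i, hspec.1, hspec.2, hasInducedCycleLen_of_isInducedPathSeq hp hspec.1 (hNp w hw)
      (hNadj w hw) hspec.2 fun j hj hjm hadj => ?_⟩
    exact Nat.findGreatest_is_greatest (P := fun i => i < m ∧ G.Adj (p i) w) hj hjm.le ⟨hjm, hadj⟩
  choose! g hgm hgadj hgcyc using hcycle
  have hNne : N.Nonempty := card_pos.1 (by omega)
  obtain ⟨w, hw, hwmin⟩ := exists_min_image N g hNne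
  refine ⟨m - g w + 2, hgcyc w hw, ?_⟩
  have hmaps : ∀ x ∈ N, g x ∈ Ico (g w) m := fun x hx => mem_Ico.2 ⟨hwmin x hx, hgm x hx⟩
  have hfib : ∀ i ∈ Ico (g w) m, #{x ∈ N | g x = i} ≤ t := by
    intro i hi
    refine (card_le_card fun x hx => ?_).trans
      (hcod (p i) (p m) (hp i m (mem_Ico.1 hi).2 le_rfl).1).le
    obtain ⟨hxN, rfl⟩ := mem_filter.1 hx
    simpa using ⟨hgadj x hxN, hNadj x hxN⟩
  have hle := card_le_mul_card_image_of_maps_to hmaps t hfib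
  have ht : 0 < t := (Nat.zero_le _).trans_lt
    (hcod (p (g w)) (p m) (hp _ m (hgm w hw) le_rfl).1)
  rw [Nat.card_Ico] at hle
  nlinarith

end InducedCycle

lemma card_inter_neighborFinset_lt {V : Type} [Fintype V] [DecidableEq V] {G : SimpleGraph V}
    [DecidableRel G.Adj] {t : ℕ}
    (hG : ¬ ∃ φ : completeBipartiteGraph (Fin 2) (Fin t) →g G, Function.Injective φ) {u v : V}
    (huv : u ≠ v) : #(G.neighborFinset u ∩ G.neighborFinset v) < t := by
  by_contra! hcard
  obtain ⟨T, hT, hTcard⟩ := exists_subset_card_eq hcard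
  let e := (T.equivFinOfCardEq hTcard).symm
  have hadj : ∀ j, G.Adj u (e j) ∧ G.Adj v (e j) := fun j => by
    simpa using hT (e j).2
  have hij : ∀ (i : Fin 2) j, G.Adj (![u, v] i) (e j) := fun i j => by
    fin_cases i
    · exact (hadj j).1
    · exact (hadj j).2
  refine hG ⟨⟨Sum.elim ![u, v] fun j => (e j : V), ?_⟩, ?_⟩
  · rintro (i | i) (j | j) h
    · simp at h
    · exact hij i j
    · exact (hij j i).symm
    · simp at h
  · refine Function.Injective.sumElim ?_ (Subtype.val_injective.comp e.injective)
      fun i j => (hij i j).ne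
    intro i j h
    fin_cases i <;> fin_cases j <;> simp_all

lemma ceil_mul_log_le {t d χ : ℝ} (ht : 2 ≤ t) (hd : 2 ≤ d) (hχ₀ : 0 ≤ χ)
    (hχ : χ ≤ 16 * t * d / Real.log d + 1) :
    χ * Real.log χ ≤ 17 * t * (Real.log (34 * t) / Real.log 2 + 1) * d := by
  have hlog2 : 0 < Real.log 2 := Real.log_pos one_lt_two
  have hlog : Real.log 2 ≤ Real.log d := Real.log_le_log two_pos hd
  have hlog34 : 0 ≤ Real.log (34 * t) := Real.log_nonneg (by linarith)
  have hlogd : 0 < Real.log d := hlog2.trans_le hlog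
  have hχ' : χ ≤ 17 * t * d / Real.log d := by
    refine hχ.trans ?_
    rw [div_add_one hlogd.ne', div_le_div_iff_of_pos_right hlogd]
    nlinarith [Real.log_le_self (by linarith : (0 : ℝ) ≤ d)]
  rcases hχ₀.eq_or_lt with rfl | hχ₀
  · simp; positivity
  have hlogχ : Real.log χ ≤ (Real.log (34 * t) / Real.log 2 + 1) * Real.log d := by
    have h : χ ≤ 34 * t * d := by
      refine hχ'.trans ?_
      rw [div_le_iff₀ hlogd]
      have : 1 / 2 ≤ Real.log d := by linarith [Real.log_two_gt_d9]
      nlinarith [mul_le_mul_of_nonneg_left this (by positivity : 0 ≤ 34 * t * d)]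
    refine (Real.log_le_log hχ₀ h).trans ?_
    rw [Real.log_mul (by positivity) (by positivity), add_one_mul, div_mul_eq_mul_div]
    gcongr
    rw [le_div_iff₀ hlog2]
    gcongr
  calc
    χ * Real.log χ ≤ χ * ((Real.log (34 * t) / Real.log 2 + 1) * Real.log d) := by gcongr
    _ ≤ 17 * t * d / Real.log d * ((Real.log (34 * t) / Real.log 2 + 1) * Real.log d) := by gcongr
    _ = _ := by field_simp

/-- for each t ≥ 2 there is c > 0 such that every regular K_{2,t}-free graph
containing a cycle has an induced cycle of length at least c·χ·log χ. -/
theorem regular_K2t_free_long_induced_cycle (t : ℕ) (ht : 2 ≤ t) :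
    ∃ c : ℝ, 0 < c ∧
      ∀ (V : Type) [Fintype V] (G : SimpleGraph V) [DecidableRel G.Adj] (d χ : ℕ),
        G.IsRegularOfDegree d →
        (¬ ∃ φ : completeBipartiteGraph (Fin 2) (Fin t) →g G, Function.Injective φ) →
        ¬ G.IsAcyclic →
        G.chromaticNumber = χ →
        ∃ ℓ : ℕ, HasInducedCycleLen G ℓ ∧ c * χ * Real.log χ ≤ ℓ := by
  have ht' : (2 : ℝ) ≤ t := by exact_mod_cast ht
  have hlog34 : 0 ≤ Real.log (34 * t) := Real.log_nonneg (by linarith)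
  set C : ℝ := 17 * t * (Real.log (34 * t) / Real.log 2 + 1)
  have hC₀ : 0 < C := by
    have := Real.log_pos one_lt_two
    positivity
  refine ⟨1 / (C * t), by positivity, ?_⟩
  intro V _ G _ d χ hreg hfree hcyc hχ
  classical
  have hcod : ∀ u v, u ≠ v → #(G.neighborFinset u ∩ G.neighborFinset v) < t :=
    fun u v => card_inter_neighborFinset_lt hfree
  obtain ⟨v₀, w, hw⟩ : ∃ (v : V) (w : G.Walk v v), w.IsCycle := by
    simpa [SimpleGraph.IsAcyclic] using hcyc
  have hd : 2 ≤ d := by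
    have hnc := hw.ncard_neighborSet_toSubgraph_eq_two w.start_mem_support
    rw [← hreg v₀, ← SimpleGraph.card_neighborFinset_eq_degree, ← hnc, ← Set.ncard_coe_finset,
      SimpleGraph.coe_neighborFinset]
    exact Set.ncard_le_ncard (w.toSubgraph.neighborSet_subset v₀) (Set.toFinite _)
  obtain ⟨ℓ, hℓ, hdℓ⟩ :=
    exists_hasInducedCycleLen_of_minDegree hcod hd (fun v => (hreg v).ge) v₀
  refine ⟨ℓ, hℓ, ?_⟩
  have hd' : (2 : ℝ) ≤ d := by exact_mod_cast hd
  have hχle : χ ≤ ⌈16 * t * d / Real.log d⌉₊ := by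
    have := (colorable_ceil_div_log ht hd hcod fun v => (hreg v).le).chromaticNumber_le
    rw [hχ] at this
    exact_mod_cast this
  have hlogd : 0 < Real.log d := Real.log_pos (by linarith)
  have hχle' : (χ : ℝ) ≤ 16 * t * d / Real.log d + 1 :=
    (Nat.cast_le.2 hχle).trans (Nat.ceil_lt_add_one (by positivity)).le
  have hmain := ceil_mul_log_le ht' hd' (Nat.cast_nonneg χ) hχle'
  have hdℓ' : (d : ℝ) ≤ ℓ * t := by exact_mod_cast hdℓ
  rw [mul_assoc, one_div, inv_mul_le_iff₀ (by positivity)]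
  calc
    _ ≤ C * d := hmain
    _ ≤ C * (ℓ * t) := by gcongr
    _ = _ := by ring
end

section
/- In any graph of girth at least 5 and minimum degree d ≥ 2, for every vertex v there are at least d! distinct induced paths on d+2 vertices having v as an endvertex. -/
namespace SimpleGraph

variable {V : Type*} {G : SimpleGraph V}

/-- The list `l` is the vertex sequence of an induced path of `G` that ends at `v`. -/
def IsInducedPathTo (G : SimpleGraph V) (v : V) : List V → Prop
  | [] => False
  | [x] => x = v
  | x :: y :: l => G.Adj x y ∧ (∀ z ∈ l, x ≠ z ∧ ¬ G.Adj x z) ∧ IsInducedPathTo G v (y :: l)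

theorem not_adj_of_five_le_egirth (h : (5 : ℕ∞) ≤ G.egirth) {a b c : V}
    (hab : G.Adj a b) (hbc : G.Adj b c) : ¬ G.Adj c a := by
  intro hca
  have hcycle : (Walk.cons hab (Walk.cons hbc (Walk.cons hca Walk.nil))).IsCycle := by
    rw [Walk.cons_isCycle_iff]
    simp [hab.ne, hab.ne', hbc.ne, hca.ne, hca.ne']
  have := le_egirth.mp h _ _ hcycle
  simp only [Walk.length_cons, Walk.length_nil] at this
  norm_cast at this

theorem eq_of_common_neighbors_of_five_le_egirth (h : (5 : ℕ∞) ≤ G.egirth) {x z a b : V}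
    (hxz : x ≠ z) (hxa : G.Adj x a) (haz : G.Adj a z) (hxb : G.Adj x b) (hbz : G.Adj b z) :
    a = b := by
  by_contra hab
  have hcycle : (Walk.cons hxa (Walk.cons haz
      (Walk.cons hbz.symm (Walk.cons hxb.symm Walk.nil)))).IsCycle := by
    rw [Walk.cons_isCycle_iff]
    simp [hxz, hxz.symm, hab, hxa.ne, hxa.ne', haz.ne, hbz.ne', hxb.ne']
  have := le_egirth.mp h _ _ hcycle
  simp only [Walk.length_cons, Walk.length_nil] at this
  norm_cast at this

theorem IsInducedPathTo.exists_walk {v : V} {x : V} {l : List V}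
    (h : G.IsInducedPathTo v (x :: l)) :
    ∃ p : G.Walk x v, p.IsPath ∧ p.toSubgraph.IsInduced ∧ p.support = x :: l := by
  induction l generalizing x with
  | nil =>
    obtain rfl : x = v := h
    refine ⟨Walk.nil, Walk.IsPath.nil, ?_, rfl⟩
    intro a ha b hb hab
    rw [Walk.mem_verts_toSubgraph, Walk.support_nil, List.mem_singleton] at ha hb
    exact absurd (ha.trans hb.symm) hab.ne
  | cons y l ih =>
    obtain ⟨hxy, hl, hyl⟩ := h
    obtain ⟨p, hp, hind, hsupp⟩ := ih hyl
    refine ⟨Walk.cons hxy p, ?_, ?_, by simp [hsupp]⟩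
    · rw [Walk.cons_isPath_iff, hsupp]
      refine ⟨hp, ?_⟩
      rw [List.mem_cons, not_or]
      exact ⟨hxy.ne, fun hx => (hl x hx).1 rfl⟩
    · have key : ∀ b ∈ p.support, G.Adj x b → b = y := by
        intro b hb hxb
        rw [hsupp, List.mem_cons] at hb
        exact hb.resolve_right fun hb => (hl b hb).2 hxb
      intro a ha b hb hab
      rw [Walk.mem_verts_toSubgraph, Walk.support_cons, List.mem_cons] at ha hb
      simp only [Walk.toSubgraph, Subgraph.sup_adj, subgraphOfAdj_adj]
      rcases ha with rfl | ha <;> rcases hb with rfl | hb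
      · exact absurd rfl hab.ne
      · left; rw [key b hb hab]
      · left; rw [key a ha hab.symm, Sym2.eq_swap]
      · right
        exact hind (by simpa using ha) (by simpa using hb) hab

section Counting

variable [Fintype V]

open Classical in
/-- The vertices that extend the induced path `l` by one more vertex at the front. -/
noncomputable def inducedPathExtensions (G : SimpleGraph V) (v : V) (l : List V) : Finset V :=
  Finset.univ.filter fun w => G.IsInducedPathTo v (w :: l)

theorem degree_le_card_inducedPathExtensions_singleton [DecidableRel G.Adj] (v : V) :
    G.degree v ≤ (G.inducedPathExtensions v [v]).card := by
  refine Finset.card_le_card fun w hw => ?_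
  rw [mem_neighborFinset] at hw
  simp [inducedPathExtensions, IsInducedPathTo, hw.symm]

theorem degree_le_card_inducedPathExtensions [DecidableRel G.Adj] (hG : (5 : ℕ∞) ≤ G.egirth)
    {v x y : V} {l : List V} (h : G.IsInducedPathTo v (x :: y :: l)) :
    G.degree x ≤ (G.inducedPathExtensions v (x :: y :: l)).card + 1 + (l.length - 1) := by
  classical
  let common : V → V := fun z => if h : ∃ w, G.Adj x w ∧ G.Adj w z then h.choose else x
  have hsub : G.neighborFinset x ⊆
      G.inducedPathExtensions v (x :: y :: l) ∪ {y} ∪ l.tail.toFinset.image common := by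
    intro w hw
    rw [mem_neighborFinset] at hw
    simp only [Finset.mem_union, Finset.mem_singleton, Finset.mem_image, List.mem_toFinset]
    by_contra! hcon
    obtain ⟨⟨hext, hwy⟩, htail⟩ := hcon
    refine hext ?_
    rw [inducedPathExtensions, Finset.mem_filter]
    refine ⟨Finset.mem_univ _, hw.symm, fun z hz => ?_, h⟩
    obtain ⟨hxy, hl, hyl⟩ := h
    rcases List.mem_cons.mp hz with rfl | hz
    · exact ⟨hwy, fun hwz => not_adj_of_five_le_egirth hG hw hwz hxy.symm⟩
    refine ⟨fun hwz => (hl z hz).2 (hwz ▸ hw), fun hwz => ?_⟩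
    cases l with
    | nil => simp at hz
    | cons u m =>
      rcases List.mem_cons.mp hz with rfl | hzm
      · have hyz : G.Adj y z := by
          cases m <;> exact hyl.1
        exact hwy (eq_of_common_neighbors_of_five_le_egirth hG (hl z hz).1 hw hwz hxy hyz)
      · refine htail z hzm ?_
        have hex : ∃ w, G.Adj x w ∧ G.Adj w z := ⟨w, hw, hwz⟩
        simp only [common, dif_pos hex]
        exact eq_of_common_neighbors_of_five_le_egirth hG (hl z hz).1 hex.choose_spec.1
          hex.choose_spec.2 hw hwz
  calc G.degree x ≤ _ := Finset.card_le_card hsub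
    _ ≤ _ := Finset.card_union_le _ _
    _ ≤ _ := by
      refine Nat.add_le_add (Finset.card_union_le _ _) ?_
      exact Finset.card_image_le.trans ((List.toFinset_card_le _).trans (by simp))

theorem exists_extended_inducedPaths {v : V} {k n : ℕ} {F : Finset (List V)}
    (hF : ∀ l ∈ F, l.length = n ∧ k ≤ (G.inducedPathExtensions v l).card) :
    ∃ F' : Finset (List V), F.card * k ≤ F'.card ∧
      ∀ l ∈ F', G.IsInducedPathTo v l ∧ l.length = n + 1 := by
  classical
  refine ⟨(F.sigma fun l => G.inducedPathExtensions v l).image fun s => s.2 :: s.1, ?_, ?_⟩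
  · rw [Finset.card_image_of_injOn, Finset.card_sigma, ← smul_eq_mul]
    · exact Finset.card_nsmul_le_sum _ _ _ fun l hl => (hF l hl).2
    · rintro ⟨a, b⟩ - ⟨c, d⟩ - h
      simp only [List.cons.injEq] at h
      obtain ⟨rfl, rfl⟩ := h
      rfl
  · intro l hl
    obtain ⟨⟨m, w⟩, hs, rfl⟩ := Finset.mem_image.mp hl
    obtain ⟨hm, hw⟩ := Finset.mem_sigma.mp hs
    exact ⟨(Finset.mem_filter.mp hw).2, by simp [(hF m hm).1]⟩

theorem exists_many_inducedPathTo [DecidableRel G.Adj] (hG : (5 : ℕ∞) ≤ G.egirth) {d : ℕ}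
    (hd : 2 ≤ d) (hmin : ∀ v, d ≤ G.degree v) (v : V) {n : ℕ} (hn : n + 1 ≤ d) :
    ∃ F : Finset (List V), d.factorial ≤ F.card * (d - 1 - n).factorial ∧
      ∀ l ∈ F, G.IsInducedPathTo v l ∧ l.length = n + 3 := by
  have hext : ∀ {m : ℕ} {l : List V}, G.IsInducedPathTo v l ∧ l.length = m + 2 →
      l.length = m + 2 ∧ d - 1 - (m - 1) ≤ (G.inducedPathExtensions v l).card := by
    rintro m l ⟨hl, hlen⟩
    obtain _ | ⟨x, _ | ⟨y, l⟩⟩ := l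
    · simp at hlen
    · simp at hlen
    · have h₁ := degree_le_card_inducedPathExtensions hG hl
      have h₂ := hmin x
      simp only [List.length_cons] at hlen ⊢
      omega
  induction n with
  | zero =>
    obtain ⟨F₁, hcard₁, hF₁⟩ := exists_extended_inducedPaths (G := G) (v := v) (k := d) (n := 1)
      (F := {[v]}) (by
        simpa using (hmin v).trans (degree_le_card_inducedPathExtensions_singleton v))
    obtain ⟨F₂, hcard₂, hF₂⟩ := exists_extended_inducedPaths (n := 0 + 2)
      fun l hl => hext (hF₁ l hl)
    refine ⟨F₂, ?_, hF₂⟩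
    have hF₂card : d ≤ F₂.card := by
      rw [Finset.card_singleton, one_mul] at hcard₁
      calc d ≤ F₁.card * 1 := by omega
        _ ≤ F₁.card * (d - 1 - (0 - 1)) := Nat.mul_le_mul_left _ (by omega)
        _ ≤ F₂.card := hcard₂
    rw [← Nat.mul_factorial_pred (by omega : d ≠ 0)]
    exact Nat.mul_le_mul_right _ hF₂card
  | succ n ih =>
    obtain ⟨F, hcard, hF⟩ := ih (by omega)
    obtain ⟨F', hcard', hF'⟩ := exists_extended_inducedPaths (n := n + 1 + 2)
      fun l hl => hext (hF l hl)
    refine ⟨F', hcard.trans ?_, hF'⟩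
    rw [Nat.add_sub_cancel] at hcard'
    rw [← Nat.mul_factorial_pred (by omega : d - 1 - n ≠ 0), ← mul_assoc, Nat.sub_sub _ n 1]
    exact Nat.mul_le_mul_right _ hcard'

end Counting

end SimpleGraph

/-- in any graph of girth at least 5 and minimum degree d ≥ 2, every vertex v is
an endvertex of at least d! distinct induced paths on d+2 vertices. -/
theorem girth5_many_induced_paths (d : ℕ) (hd : 2 ≤ d)
    {V : Type} [Fintype V] (G : SimpleGraph V) [DecidableRel G.Adj]
    (hgirth : (5 : ℕ∞) ≤ G.egirth)
    (hmin : ∀ v : V, d ≤ G.degree v) (v : V) :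
    ∃ F : Finset (List V), Nat.factorial d ≤ F.card ∧
      ∀ l ∈ F, ∃ (u : V) (p : G.Walk v u),
        p.IsPath ∧ p.toSubgraph.IsInduced ∧ p.support = l ∧ l.length = d + 2 := by
  classical
  obtain ⟨F, hcard, hF⟩ :=
    SimpleGraph.exists_many_inducedPathTo hgirth hd hmin v (n := d - 1) (by omega)
  refine ⟨F.image List.reverse, ?_, ?_⟩
  · rw [Finset.card_image_of_injective _ List.reverse_injective]
    simpa using hcard
  · intro l hl
    obtain ⟨m, hm, rfl⟩ := Finset.mem_image.mp hl
    obtain ⟨hpath, hlen⟩ := hF m hm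
    cases m with
    | nil => exact hpath.elim
    | cons x m =>
      obtain ⟨p, hp, hind, hsupp⟩ := hpath.exists_walk
      refine ⟨x, p.reverse, hp.reverse, ?_, ?_, ?_⟩
      · rwa [SimpleGraph.Walk.toSubgraph_reverse]
      · rw [SimpleGraph.Walk.support_reverse, hsupp]
      · rw [List.length_reverse, hlen]
        omega
end

section
/- Let G be a graph of girth at least 5 and minimum degree at least d. Let T be a forest on d vertices with connected components T₁, …, T_t, and for each 1 ≤ i ≤ t let u_i be a vertex of T_i. Let S = {v₁, …, v_t} be any independent set of G of size t. Then there exists an injective map f from the vertices of T to the vertices of G such that f(u_i) = v_i for all 1 ≤ i ≤ t and such that the subgraph of G induced on the image f(V(T)) is isomorphic to T via f (i.e. f(x)f(y) is an edge of G if and only if xy is an edge of T). -/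
namespace SimpleGraph

variable {V W : Type*} {G : SimpleGraph V} {T : SimpleGraph W}

theorem not_triangle_of_five_le_egirth (hG : (5 : ℕ∞) ≤ G.egirth) {a b c : V}
    (hab : G.Adj a b) (hbc : G.Adj b c) (hca : G.Adj c a) : False := by
  have hcyc : (Walk.cons hab (.cons hbc (.cons hca .nil))).IsCycle := by
    have h₁ := hab.ne
    have h₂ := hbc.ne
    have h₃ := hca.ne
    simp [Walk.isCycle_def, Walk.isTrail_def]
    grind
  have h := le_egirth.mp hG a _ hcyc
  simp only [Walk.length_cons, Walk.length_nil] at h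
  exact absurd (by exact_mod_cast h : 5 ≤ 0 + 1 + 1 + 1) (by decide)

theorem eq_of_common_neighbors_of_five_le_egirth_s17 (hG : (5 : ℕ∞) ≤ G.egirth) {a x y z : V}
    (hax : a ≠ x) (hxy : G.Adj x y) (hxz : G.Adj x z) (hay : G.Adj a y) (haz : G.Adj a z) :
    y = z := by
  by_contra hyz
  have hcyc : (Walk.cons hxy (.cons hay.symm (.cons haz (.cons hxz.symm .nil)))).IsCycle := by
    have h₁ := hxy.ne
    have h₂ := hxz.ne
    have h₃ := hay.ne
    have h₄ := haz.ne
    simp [Walk.isCycle_def, Walk.isTrail_def]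
    grind
  have h := le_egirth.mp hG x _ hcyc
  simp only [Walk.length_cons, Walk.length_nil] at h
  exact absurd (by exact_mod_cast h : 5 ≤ 0 + 1 + 1 + 1 + 1) (by decide)

/-- In a graph of girth at least five, a set no larger than the degree of its member `x` can be
extended by a neighbor of `x` that is adjacent to no other member. -/
theorem exists_private_neighbor_of_five_le_egirth (hG : (5 : ℕ∞) ≤ G.egirth) (A : Finset V)
    {x : V} [Fintype (G.neighborSet x)] (hx : x ∈ A) (hA : A.card ≤ G.degree x) :
    ∃ w, G.Adj x w ∧ w ∉ A ∧ ∀ a ∈ A, G.Adj a w → a = x := by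
  classical
  by_contra! hcon
  have hblock : ∀ w, ∃ a, G.Adj x w → a ∈ A.erase x ∧ (a = w ∨ G.Adj a w) := by
    intro w
    by_cases hxw : G.Adj x w
    · by_cases hw : w ∈ A
      · exact ⟨w, fun _ => ⟨Finset.mem_erase.mpr ⟨hxw.ne', hw⟩, .inl rfl⟩⟩
      · obtain ⟨a, ha, haw, hax⟩ := hcon w hxw hw
        exact ⟨a, fun _ => ⟨Finset.mem_erase.mpr ⟨hax, ha⟩, .inr haw⟩⟩
    · exact ⟨w, fun h => absurd h hxw⟩
  choose g hg using hblock
  have hlt : (A.erase x).card < (G.neighborFinset x).card := by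
    rw [card_neighborFinset_eq_degree]
    exact (Finset.card_erase_lt_of_mem hx).trans_le hA
  obtain ⟨y, hy, z, hz, hyz, heq⟩ := Finset.exists_ne_map_eq_of_card_lt_of_maps_to hlt
    (f := g) (fun w hw => (hg w ((mem_neighborFinset _ _ _).mp hw)).1)
  rw [mem_neighborFinset] at hy hz
  obtain ⟨hgA, hgy⟩ := hg y hy
  have hgz := (hg z hz).2
  rw [← heq] at hgz
  have hgx := Finset.ne_of_mem_erase hgA
  rcases hgy with hgy | hgy <;> rcases hgz with hgz | hgz
  · exact hyz (hgy.symm.trans hgz)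
  · exact not_triangle_of_five_le_egirth hG hy (hgy ▸ hgz) hz.symm
  · exact not_triangle_of_five_le_egirth hG hz (hgz ▸ hgy) hy.symm
  · exact hyz (eq_of_common_neighbors_of_five_le_egirth_s17 hG hgx hy hz hgy hgz)

/-- In an acyclic graph, a vertex has at most one neighbor on any walk that avoids it. -/
theorem IsAcyclic.eq_of_adj_of_notMem_support (hT : T.IsAcyclic) {x y z : W} (p : T.Walk x z)
    (hy : y ∉ p.support) (hxy : T.Adj x y) (hzy : T.Adj z y) : x = z := by
  classical
  by_contra hxz
  have hpath : (Walk.cons hxy (.cons hzy.symm .nil)).IsPath := by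
    have h₁ := hxy.ne
    have h₂ := hzy.ne
    simp [Walk.isPath_def]
    grind
  have h := (hT.subsingleton_path x z).elim p.toPath ⟨_, hpath⟩
  have hsup : y ∈ (p.toPath : T.Walk x z).support := by
    rw [h]
    simp
  exact hy (p.support_toPath_subset_support hsup)

/-- An induced embedding of a part `X` of a forest, containing a root `u c` of every component and
connected to the roots within `X`, extends to an induced embedding of the whole forest. -/
theorem IsAcyclic.exists_induced_extension [Fintype W] [G.LocallyFinite]
    (hT : T.IsAcyclic) (hG : (5 : ℕ∞) ≤ G.egirth)
    (hdeg : ∀ x, Fintype.card W ≤ G.degree x) (u : T.ConnectedComponent → W)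
    (hu : ∀ c, T.connectedComponentMk (u c) = c) (X : Finset W) (f : W → V)
    (hroot : ∀ c, u c ∈ X)
    (hwalk : ∀ a ∈ X, ∃ p : T.Walk (u (T.connectedComponentMk a)) a, ∀ b ∈ p.support, b ∈ X)
    (hinj : Set.InjOn f X) (hadj : ∀ a ∈ X, ∀ b ∈ X, G.Adj (f a) (f b) ↔ T.Adj a b) :
    ∃ g : W → V, Function.Injective g ∧ (∀ a ∈ X, g a = f a) ∧
      ∀ a b, G.Adj (g a) (g b) ↔ T.Adj a b := by
  classical
  induction hn : Xᶜ.card generalizing X f with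
  | zero =>
    obtain rfl : X = Finset.univ := by simpa using hn
    exact ⟨f, by simpa [Set.injOn_univ] using hinj, fun _ _ => rfl, by simpa using hadj⟩
  | succ n ih =>
    obtain ⟨y₀, hy₀⟩ : Xᶜ.Nonempty := Finset.card_pos.mp (by omega)
    obtain ⟨q⟩ : T.Reachable (u (T.connectedComponentMk y₀)) y₀ :=
      ConnectedComponent.exact (hu _)
    obtain ⟨e, -, hx, hy⟩ := q.exists_boundary_dart (X : Set W) (hroot _) (by simpa using hy₀)
    obtain ⟨⟨x, y⟩, hxy⟩ := e
    simp only [Finset.mem_coe] at hx hy hxy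
    have huniq : ∀ a ∈ X, T.Adj a y → a = x := by
      intro a ha hay
      have hc : T.connectedComponentMk a = T.connectedComponentMk x :=
        ConnectedComponent.sound (hay.reachable.trans hxy.symm.reachable)
      have hpa := hwalk a ha
      rw [hc] at hpa
      obtain ⟨p, hp⟩ := hpa
      obtain ⟨r, hr⟩ := hwalk x hx
      refine hT.eq_of_adj_of_notMem_support (p.reverse.append r) (fun h => ?_) hay hxy
      rw [Walk.mem_support_append_iff, Walk.support_reverse, List.mem_reverse] at h
      exact hy (h.elim (hp y) (hr y))
    obtain ⟨w, hxw, hwX, hw⟩ := exists_private_neighbor_of_five_le_egirth hG (X.image f)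
      (Finset.mem_image_of_mem f hx)
      ((Finset.card_image_le.trans (Finset.card_le_univ X)).trans (hdeg _))
    have hfw : ∀ a ∈ X, f a ≠ w := fun a ha h => hwX (h ▸ Finset.mem_image_of_mem f ha)
    have hold : ∀ a ∈ X, Function.update f y w a = f a := fun a ha =>
      Function.update_of_ne (ne_of_mem_of_not_mem ha hy) _ _
    have hnew : ∀ a ∈ X, (G.Adj (f a) w ↔ T.Adj a y) := by
      intro a ha
      constructor
      · intro h
        rwa [hinj ha hx (hw _ (Finset.mem_image_of_mem f ha) h)]
      · intro h
        rwa [huniq a ha h]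
    refine (ih (insert y X) (Function.update f y w)
      (fun c => Finset.mem_insert_of_mem (hroot c)) ?_ ?_ ?_ ?_).imp
        fun g ⟨hg, hgX, hgadj⟩ => ⟨hg, fun a ha => (hgX a (Finset.mem_insert_of_mem ha)).trans (hold a ha),
          hgadj⟩
    · intro a ha
      rcases Finset.mem_insert.mp ha with rfl | ha
      · obtain ⟨r, hr⟩ := hwalk x hx
        have hc : T.connectedComponentMk x = T.connectedComponentMk a :=
          ConnectedComponent.sound hxy.reachable
        rw [← hc]
        refine ⟨r.concat hxy, fun b hb => ?_⟩
        rw [Walk.support_concat] at hb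
        simp only [List.mem_append, List.mem_singleton] at hb
        exact hb.elim (fun h => Finset.mem_insert_of_mem (hr b h))
          (fun h => h ▸ Finset.mem_insert_self _ _)
      · obtain ⟨r, hr⟩ := hwalk a ha
        exact ⟨r, fun b hb => Finset.mem_insert_of_mem (hr b hb)⟩
    · intro a hay b hby hab
      rcases Finset.mem_insert.mp hay with rfl | ha <;>
        rcases Finset.mem_insert.mp hby with rfl | hb
      · rfl
      · rw [hold b hb, Function.update_self] at hab
        exact absurd hab.symm (hfw b hb)
      · rw [hold a ha, Function.update_self] at hab
        exact absurd hab (hfw a ha)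
      · rw [hold a ha, hold b hb] at hab
        exact hinj ha hb hab
    · intro a hay b hby
      rcases Finset.mem_insert.mp hay with rfl | ha <;>
        rcases Finset.mem_insert.mp hby with rfl | hb
      · simp
      · rw [hold b hb, Function.update_self, G.adj_comm, T.adj_comm, hnew b hb]
      · rw [hold a ha, Function.update_self, hnew a ha]
      · rw [hold a ha, hold b hb, hadj a ha b hb]
    · rw [Finset.compl_insert, Finset.card_erase_of_mem (by simpa using hy), hn]
      rfl

end SimpleGraph


/-- let G have girth at least 5 and minimum degree at least d, let T be a forest
on d vertices with a chosen vertex in each component, and let S = {v₁,…,v_t} be an independent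
set of G with one vertex per component of T. Then T embeds in G as an induced subgraph, with
the chosen vertex of each component mapped to the corresponding vertex of S. -/
theorem girth5_induced_rooted_forest
    {V W : Type} [Fintype V] [Fintype W] (d : ℕ)
    (G : SimpleGraph V) [DecidableRel G.Adj] (T : SimpleGraph W)
    (hgirth : (5 : ℕ∞) ≤ G.egirth)
    (hmin : ∀ x : V, d ≤ G.degree x)
    (hT : T.IsAcyclic) (hcard : Fintype.card W = d)
    (u : T.ConnectedComponent → W)
    (hu : ∀ comp : T.ConnectedComponent, T.connectedComponentMk (u comp) = comp)
    (v : T.ConnectedComponent → V) (hv : Function.Injective v)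
    (hindep : ∀ c₁ c₂ : T.ConnectedComponent, ¬ G.Adj (v c₁) (v c₂)) :
    ∃ f : W → V, Function.Injective f ∧
      (∀ comp : T.ConnectedComponent, f (u comp) = v comp) ∧
      ∀ x y : W, G.Adj (f x) (f y) ↔ T.Adj x y := by
  classical
  subst hcard
  have hroot : ∀ c, u c ∈ Finset.univ.image u := fun c => Finset.mem_image_of_mem u (by simp)
  refine (hT.exists_induced_extension hgirth hmin u hu (Finset.univ.image u)
    (fun a => v (T.connectedComponentMk a)) hroot ?_ ?_ ?_).imp
      fun f ⟨hf, hfu, hfadj⟩ => ⟨hf, fun c => by rw [hfu _ (hroot c), hu], hfadj⟩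
  · intro a ha
    obtain ⟨c, -, rfl⟩ := Finset.mem_image.mp ha
    rw [hu]
    exact ⟨.nil, by simp⟩
  · intro a ha b hb hab
    obtain ⟨c, -, rfl⟩ := Finset.mem_image.mp ha
    obtain ⟨c', -, rfl⟩ := Finset.mem_image.mp hb
    simp only [hu] at hab
    rw [hv hab]
  · intro a ha b hb
    obtain ⟨c, -, rfl⟩ := Finset.mem_image.mp ha
    obtain ⟨c', -, rfl⟩ := Finset.mem_image.mp hb
    refine iff_of_false (hindep _ _) fun h => h.ne ?_
    rw [← hu c, ← hu c', SimpleGraph.ConnectedComponent.sound h.reachable]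
end
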